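/- Let q > 1 be real, n ∈ ℕ, and t a nonzero complex number. Then t^{2n+1} · ₂φ₁(q^{4n}, q^{4n+2}; 0; q^{−4}, −q^{−4}/t²) = (−1)^n q^{4n²+2n} (q^{−6};q^{−4})_n · t · ₁φ₁(q^{4n}; q^{−6}; q^{−4}, −q^{−4n−6} t²). (Both series terminate since (q^{4n};q^{−4})_j = 0 for j > n, so this is an identity of polynomials in t, relating the odd q-Hermite II polynomial h̃_{2n+1} to an ₁φ₁ eigenfunction.) -/

import Mathlib

open scoped BigOperators

/-- The q-shifted factorial `(a;p)_n = ∏_{i=0}^{n-1} (1 - a p^i)`. -/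
noncomputable def qPoch (a p : ℂ) (n : ℕ) : ℂ :=
  ∏ i ∈ Finset.range n, (1 - a * p ^ i)

/-- The basic hypergeometric series
`₁φ₁(a;c;p,z) = ∑_{j=0}^∞ ((a;p)_j / ((p;p)_j (c;p)_j)) (-1)^j p^(j(j-1)/2) z^j`. -/
noncomputable def phi11 (a c p z : ℂ) : ℂ :=
  ∑' j : ℕ, qPoch a p j / (qPoch p p j * qPoch c p j) * (-1) ^ j *
    p ^ (j * (j - 1) / 2) * z ^ j

/-- The basic hypergeometric series
`₂φ₁(a,b;0;p,z) = ∑_{j=0}^∞ ((a;p)_j (b;p)_j / (p;p)_j) z^j`. -/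
noncomputable def phi21 (a b p z : ℂ) : ℂ :=
  ∑' j : ℕ, qPoch a p j * qPoch b p j / qPoch p p j * z ^ j

theorem qPoch_succ (a p : ℂ) (n : ℕ) :
    qPoch a p (n + 1) = qPoch a p n * (1 - a * p ^ n) :=
  Finset.prod_range_succ _ _

/-- Reversal of the last `j` factors of a q-shifted factorial. -/
theorem qPoch_add_of_mul_eq {a c p : ℂ} (hp : p ≠ 0) (j k : ℕ) (h : a * c * p ^ (k + j) = p) :
    qPoch c p (k + j) = qPoch c p k * qPoch a p j * (-c) ^ j * p ^ (j * k + j.choose 2) := by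
  induction j generalizing k with
  | zero => simp [qPoch]
  | succ j ih =>
    have h1 : a * c * p ^ (k + j) = 1 := by
      apply mul_right_cancel₀ hp
      rw [one_mul, mul_assoc, ← pow_succ]
      exact h
    have h2 : 1 - c * p ^ k = -c * p ^ k * (1 - a * p ^ j) := by
      linear_combination -h1
    have h3 := ih (k + 1) (by rw [show k + 1 + j = k + (j + 1) by ring, h])
    rw [show k + (j + 1) = k + 1 + j by ring, h3, qPoch_succ c, qPoch_succ a, h2,
      Nat.choose_succ_succ' j 1, Nat.choose_one_right]
    ring

theorem qPoch_ne_zero {a p : ℂ} (n : ℕ) (h : ∀ i, a * p ^ i ≠ 1) : qPoch a p n ≠ 0 :=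
  Finset.prod_ne_zero_iff.2 fun i _ => sub_ne_zero.2 (h i).symm

theorem qPoch_eq_zero {a p : ℂ} {n j : ℕ} (h : a * p ^ n = 1) (hj : n < j) : qPoch a p j = 0 :=
  Finset.prod_eq_zero (Finset.mem_range.2 hj) (by rw [h, sub_self])

/-- The `j`-th term of the `₂φ₁` side agrees with the `k`-th term of the `₁φ₁` side
when `j + k` is the degree. -/
theorem phi21_term_eq_phi11_term {r t a b : ℂ} (j k : ℕ) (hr : r ≠ 0) (ht : t ≠ 0)
    (ha : a * r ^ (4 * (j + k)) = 1) (hb : b * r ^ 2 = a)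
    (hj : qPoch (r ^ 4) (r ^ 4) j ≠ 0) (hk : qPoch (r ^ 4) (r ^ 4) k ≠ 0)
    (hc : qPoch (r ^ 6) (r ^ 4) k ≠ 0) :
    t ^ (2 * (j + k) + 1) *
        (qPoch a (r ^ 4) j * qPoch b (r ^ 4) j / qPoch (r ^ 4) (r ^ 4) j * (-r ^ 4 / t ^ 2) ^ j) =
      (-1) ^ (j + k) * (r ^ (4 * (j + k) ^ 2 + 2 * (j + k)))⁻¹ * qPoch (r ^ 6) (r ^ 4) (j + k) * t *
        (qPoch a (r ^ 4) k / (qPoch (r ^ 4) (r ^ 4) k * qPoch (r ^ 6) (r ^ 4) k) * (-1) ^ k *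
          (r ^ 4) ^ (k * (k - 1) / 2) * (-r ^ (4 * (j + k) + 6) * t ^ 2) ^ k) := by
  have hr4 : r ^ 4 ≠ 0 := pow_ne_zero _ hr
  have e1 := qPoch_add_of_mul_eq (a := a) (c := r ^ 4) hr4 j k
    (by linear_combination r ^ 4 * ha)
  have e2 := qPoch_add_of_mul_eq (a := a) (c := r ^ 4) hr4 k j
    (by linear_combination r ^ 4 * ha)
  have e3 := qPoch_add_of_mul_eq (a := b) (c := r ^ 6) hr4 j k
    (by linear_combination r ^ 4 * ha + r ^ (4 * (j + k) + 4) * hb)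
  rw [add_comm j k] at *
  rw [e1] at e2
  have e4 : qPoch a (r ^ 4) k = qPoch (r ^ 4) (r ^ 4) k * qPoch a (r ^ 4) j * (-r ^ 4) ^ j *
      (r ^ 4) ^ (j * k + j.choose 2) /
      (qPoch (r ^ 4) (r ^ 4) j * (-r ^ 4) ^ k * (r ^ 4) ^ (k * j + k.choose 2)) := by
    rw [eq_div_iff (by simp [hr, hj]), e2]
    ring
  rw [e3, e4, ← Nat.choose_two_right]
  generalize qPoch (r ^ 4) (r ^ 4) j = Pj at *
  generalize qPoch (r ^ 4) (r ^ 4) k = Pk at *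
  generalize qPoch (r ^ 6) (r ^ 4) k = Ck at *
  generalize qPoch a (r ^ 4) j = A at *
  generalize qPoch b (r ^ 4) j = B at *
  have hD : j ^ 2 = 2 * j.choose 2 + j := by
    clear * -
    induction j with
    | zero => rfl
    | succ j ih =>
      rw [Nat.choose_succ_succ' j 1, Nat.choose_one_right]
      linarith
  generalize j.choose 2 = D at *
  generalize k.choose 2 = E at *
  have hs : r ^ (4 * (k + j) ^ 2 + 2 * (k + j)) =
      r ^ (4 * k ^ 2 + 8 * (k * j) + 8 * D + 6 * j + 2 * k) := by
    congr 1
    linear_combination 4 * hD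
  rw [hs, neg_pow (r ^ 6), neg_pow (r ^ 4) j, neg_pow (r ^ 4) k, neg_mul,
    neg_pow (r ^ (4 * (k + j) + 6) * t ^ 2), neg_div, neg_pow (r ^ 4 / t ^ 2), pow_add (-1 : ℂ)]
  have hs1 : ((-1 : ℂ) ^ j) * (-1) ^ j = 1 := by rw [← mul_pow]; simp
  have hs2 : ((-1 : ℂ) ^ k) * (-1) ^ k = 1 := by rw [← mul_pow]; simp
  have hm1 : (-1 : ℂ) ^ k ≠ 0 := by simp
  simp only [mul_pow, div_pow, ← pow_mul]
  generalize (-1 : ℂ) ^ j = x at *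
  generalize (-1 : ℂ) ^ k = y at *
  field_simp
  rw [show x ^ 3 = x by linear_combination x * hs1, show y ^ 2 = 1 by linear_combination hs2]
  ring

/-- The odd q-Hermite II polynomial as a `₁φ₁` eigenfunction:
`t^{2n+1} ₂φ₁(q^{4n}, q^{4n+2}; 0; q⁻⁴, -q⁻⁴/t²)
  = (-1)^n q^{4n²+2n} (q⁻⁶;q⁻⁴)_n t ₁φ₁(q^{4n}; q⁻⁶; q⁻⁴, -q^{-4n-6} t²)`. -/
theorem odd_hermite_phi11 (q : ℝ) (hq : 1 < q) (n : ℕ) (t : ℂ) (ht : t ≠ 0) :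
    t ^ (2 * n + 1) * phi21 ((q : ℂ) ^ (4 * (n : ℤ))) ((q : ℂ) ^ (4 * (n : ℤ) + 2))
        ((q : ℂ) ^ (-4 : ℤ)) (-(q : ℂ) ^ (-4 : ℤ) / t ^ 2) =
      (-1) ^ n * (q : ℂ) ^ (4 * (n : ℤ) ^ 2 + 2 * (n : ℤ)) *
        qPoch ((q : ℂ) ^ (-6 : ℤ)) ((q : ℂ) ^ (-4 : ℤ)) n * t *
        phi11 ((q : ℂ) ^ (4 * (n : ℤ))) ((q : ℂ) ^ (-6 : ℤ)) ((q : ℂ) ^ (-4 : ℤ))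
          (-(q : ℂ) ^ (-4 * (n : ℤ) - 6) * t ^ 2) := by
  set r : ℂ := (q : ℂ)⁻¹ with hr_def
  have hq0 : (q : ℂ) ≠ 0 := by exact_mod_cast (by linarith : q ≠ 0)
  have hr : r ≠ 0 := inv_ne_zero hq0
  have hr1 : ∀ m : ℕ, 0 < m → r ^ m ≠ 1 := fun m hm h => by
    have h1 : q ^ m = 1 := by
      rw [hr_def, inv_pow, inv_eq_one] at h
      exact_mod_cast h
    exact (one_lt_pow₀ hq hm.ne').ne' h1
  have hz : ∀ m : ℕ, (q : ℂ) ^ (-(m : ℤ)) = r ^ m := fun m => by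
    rw [zpow_neg, zpow_natCast, hr_def, inv_pow]
  have z4 : (q : ℂ) ^ (-4 : ℤ) = r ^ 4 := hz 4
  have z6 : (q : ℂ) ^ (-6 : ℤ) = r ^ 6 := hz 6
  have zn : (q : ℂ) ^ (-4 * (n : ℤ) - 6) = r ^ (4 * n + 6) := by
    rw [← hz]; congr 1; push_cast; ring
  have zq : (q : ℂ) ^ (4 * (n : ℤ) ^ 2 + 2 * (n : ℤ)) = (r ^ (4 * n ^ 2 + 2 * n))⁻¹ := by
    rw [← hz, ← zpow_neg]; congr 1; push_cast; ring
  have ha : (q : ℂ) ^ (4 * (n : ℤ)) * r ^ (4 * n) = 1 := by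
    rw [← hz, ← zpow_add₀ hq0]; simp
  have hb : (q : ℂ) ^ (4 * (n : ℤ) + 2) * r ^ 2 = (q : ℂ) ^ (4 * (n : ℤ)) := by
    rw [← hz, ← zpow_add₀ hq0]; simp
  rw [z4, z6, zn, zq]
  generalize (q : ℂ) ^ (4 * (n : ℤ) + 2) = b at *
  generalize (q : ℂ) ^ (4 * (n : ℤ)) = a at *
  have hA : ∀ j, j ∉ Finset.range (n + 1) → qPoch a (r ^ 4) j = 0 := fun j hj =>
    qPoch_eq_zero (n := n) (by rwa [← pow_mul]) (not_le.1 fun h => hj (Finset.mem_range_succ_iff.2 h))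
  have hP : ∀ m l : ℕ, 0 < m → qPoch (r ^ m) (r ^ 4) l ≠ 0 := fun m l hm =>
    qPoch_ne_zero l fun i => by
      rw [← pow_mul, ← pow_add]
      exact hr1 _ (by omega)
  rw [phi21, phi11, tsum_eq_sum (s := Finset.range (n + 1)) fun j hj => by rw [hA j hj]; simp,
    tsum_eq_sum (s := Finset.range (n + 1)) fun j hj => by rw [hA j hj]; simp,
    Finset.mul_sum, Finset.mul_sum, ← Finset.sum_range_reflect]
  refine Finset.sum_congr rfl fun k hk => ?_
  obtain ⟨j, rfl⟩ := Nat.exists_eq_add_of_le' (Nat.lt_succ_iff.1 (Finset.mem_range.1 hk))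
  rw [show j + k + 1 - 1 - k = j by omega]
  exact phi21_term_eq_phi11_term j k hr ht ha hb (hP 4 j (by norm_num)) (hP 4 k (by norm_num))
    (hP 6 k (by norm_num))
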